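/- arXiv:1701.04982 — 6 statements merged into one kernel-verified Lean document; each statement's English description precedes it below -/
import Mathlib

section
/- For every real x > 0, the zeroth-order modified Bessel function of the first kind satisfies I₀(x) ≤ (e^x/(4√x)) · ( √π · erf(√x) + 2·e^{−x}·(1 − e^{−x})/√x ). -/
open Real MeasureTheory intervalIntegral

/-- The zeroth-order modified Bessel function of the first kind,
`I₀(x) = (1/π) ∫₀^π e^{x cos θ} dθ`. -/
noncomputable def besselI0 (x : ℝ) : ℝ :=
  (1 / π) * ∫ θ in (0:ℝ)..π, Real.exp (x * Real.cos θ)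

/-- The error function `erf(x) = (2/√π) ∫₀^x e^{−t²} dt`. -/
noncomputable def erf (x : ℝ) : ℝ :=
  (2 / Real.sqrt π) * ∫ t in (0:ℝ)..x, Real.exp (-t ^ 2)

lemma cos_le_one_sub_sq_of_le_pi_div_two {θ : ℝ} (h0 : 0 ≤ θ) (h1 : θ ≤ π / 2) :
    Real.cos θ ≤ 1 - (2 / π * θ) ^ 2 := by
  have hπ := Real.pi_pos
  have hs : √2 * θ / π ≤ Real.sin (θ / 2) := by
    have hc := strictConcaveOn_sin_Icc.concaveOn.2
      (Set.left_mem_Icc.2 hπ.le) (show π / 4 ∈ Set.Icc 0 π from ⟨by positivity, by linarith⟩)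
      (show 0 ≤ 1 - 2 * θ / π by rw [sub_nonneg, div_le_one hπ]; linarith)
      (show 0 ≤ 2 * θ / π by positivity) (by ring)
    simp only [smul_eq_mul, Real.sin_zero, Real.sin_pi_div_four, mul_zero, zero_add] at hc
    calc √2 * θ / π = 2 * θ / π * (√2 / 2) := by ring
      _ ≤ _ := hc
      _ = Real.sin (θ / 2) := by congr 1; field_simp; ring
  have hsq : (√2 * θ / π) ^ 2 ≤ Real.sin (θ / 2) ^ 2 :=
    pow_le_pow_left₀ (by positivity) hs 2
  have h2 : (√2 * θ / π) ^ 2 = (2 / π * θ) ^ 2 / 2 := by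
    rw [div_pow, mul_pow, Real.sq_sqrt zero_le_two]; ring
  have h3 : Real.cos θ = 1 - 2 * Real.sin (θ / 2) ^ 2 := by
    rw [← Real.cos_sq_add_sin_sq (θ / 2)]
    conv_lhs => rw [show θ = 2 * (θ / 2) by ring, Real.cos_two_mul']
    ring
  linarith

lemma cos_le_one_sub_of_pi_div_two_le {θ : ℝ} (h0 : π / 2 ≤ θ) (h1 : θ ≤ π) :
    Real.cos θ ≤ 1 - 2 / π * θ := by
  have h := Real.mul_le_sin (x := θ - π / 2) (by linarith) (by linarith)
  rw [Real.sin_sub_pi_div_two] at h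
  have : 2 / π * (π / 2) = 1 := by field_simp
  linarith

lemma integral_exp_mul_cos_le_erf {x : ℝ} (hx : 0 < x) :
    ∫ θ in (0:ℝ)..(π / 2), Real.exp (x * Real.cos θ) ≤
      π * (Real.exp x / (4 * √x)) * (√π * erf (√x)) := by
  have hπ := Real.pi_pos
  have hsx : 0 < √x := Real.sqrt_pos.2 hx
  calc ∫ θ in (0:ℝ)..(π / 2), Real.exp (x * Real.cos θ)
      ≤ ∫ θ in (0:ℝ)..(π / 2), Real.exp x * Real.exp (-(√x * (2 / π) * θ) ^ 2) := by
        refine integral_mono_on (by positivity)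
          (Continuous.intervalIntegrable (by fun_prop) _ _)
          (Continuous.intervalIntegrable (by fun_prop) _ _) fun θ hθ => ?_
        rw [← Real.exp_add, Real.exp_le_exp, mul_assoc, mul_pow, Real.sq_sqrt hx.le]
        have := mul_le_mul_of_nonneg_left
          (cos_le_one_sub_sq_of_le_pi_div_two hθ.1 hθ.2) hx.le
        linarith
    _ = π * (Real.exp x / (4 * √x)) * (√π * erf (√x)) := by
        rw [intervalIntegral.integral_const_mul,
          integral_comp_mul_left (fun t => Real.exp (-t ^ 2)) (by positivity), erf,
          mul_zero, show √x * (2 / π) * (π / 2) = √x by field_simp]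
        have : 0 < √π := Real.sqrt_pos.2 hπ
        rw [smul_eq_mul]
        field_simp
        ring

lemma integral_exp_mul_cos_le_one_sub_exp {x : ℝ} (hx : 0 < x) :
    ∫ θ in (π / 2)..π, Real.exp (x * Real.cos θ) ≤
      π * ((1 - Real.exp (-x)) / (2 * x)) := by
  have hπ := Real.pi_pos
  calc ∫ θ in (π / 2)..π, Real.exp (x * Real.cos θ)
      ≤ ∫ θ in (π / 2)..π, Real.exp (x - x * (2 / π) * θ) := by
        refine integral_mono_on (by linarith)
          (Continuous.intervalIntegrable (by fun_prop) _ _)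
          (Continuous.intervalIntegrable (by fun_prop) _ _) fun θ hθ => ?_
        rw [Real.exp_le_exp]
        have := mul_le_mul_of_nonneg_left
          (cos_le_one_sub_of_pi_div_two_le hθ.1 hθ.2) hx.le
        linarith
    _ = π * ((1 - Real.exp (-x)) / (2 * x)) := by
        rw [integral_comp_sub_mul (fun t => Real.exp t) (by positivity), integral_exp,
          show x - x * (2 / π) * π = -x by field_simp; ring,
          show x - x * (2 / π) * (π / 2) = 0 by field_simp; ring, Real.exp_zero, smul_eq_mul]
        field_simp

theorem besselI0_le_erf_bound (x : ℝ) (hx : 0 < x) :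
    besselI0 x ≤ (Real.exp x / (4 * Real.sqrt x)) *
      (Real.sqrt π * erf (Real.sqrt x) +
        2 * Real.exp (-x) * (1 - Real.exp (-x)) / Real.sqrt x) := by
  have hπ := Real.pi_pos
  have hcont : Continuous fun θ : ℝ => Real.exp (x * Real.cos θ) := by fun_prop
  have hsecond : (Real.exp x / (4 * √x)) * (2 * Real.exp (-x) * (1 - Real.exp (-x)) / √x) =
      (1 - Real.exp (-x)) / (2 * x) := by
    have hexp : Real.exp x * Real.exp (-x) = 1 := by rw [← Real.exp_add]; simp
    calc _ = (Real.exp x * Real.exp (-x)) * (1 - Real.exp (-x)) / (2 * (√x * √x)) := by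
          field_simp; ring
      _ = _ := by rw [hexp, Real.mul_self_sqrt hx.le, one_mul]
  rw [besselI0, ← integral_add_adjacent_intervals (hcont.intervalIntegrable 0 (π / 2))
    (hcont.intervalIntegrable (π / 2) π), mul_add (Real.exp x / _), hsecond, one_div,
    inv_mul_le_iff₀ hπ, mul_add, ← mul_assoc π]
  exact add_le_add (integral_exp_mul_cos_le_erf hx) (integral_exp_mul_cos_le_one_sub_exp hx)
end

section
/- For every real x > 0, the zeroth-order modified Bessel function of the first kind satisfies I₀(x) ≤ ((√π + 1)/4) · e^x/√x. -/
open Real MeasureTheory intervalIntegral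

theorem integral_exp_mul_cos_le (x : ℝ) (hx : 0 < x) :
    ∫ θ in (0:ℝ)..π, Real.exp (x * Real.cos θ) ≤
      Real.exp x * (√(π / (2 * x / π ^ 2)) / 2) := by
  have hb : 0 < 2 * x / π ^ 2 := by positivity
  have hint := integrable_exp_neg_mul_sq hb
  calc ∫ θ in (0:ℝ)..π, Real.exp (x * Real.cos θ)
      ≤ ∫ θ in (0:ℝ)..π, Real.exp x * Real.exp (-(2 * x / π ^ 2) * θ ^ 2) := by
        refine integral_mono_on pi_pos.le (Continuous.intervalIntegrable (by fun_prop) _ _)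
          (Continuous.intervalIntegrable (by fun_prop) _ _) fun θ hθ => ?_
        rw [← Real.exp_add, Real.exp_le_exp]
        have hcos := Real.cos_le_one_sub_mul_cos_sq (abs_le.2 ⟨by linarith [hθ.1, pi_pos], hθ.2⟩)
        calc x * Real.cos θ ≤ x * (1 - 2 / π ^ 2 * θ ^ 2) := by gcongr
          _ = x + -(2 * x / π ^ 2) * θ ^ 2 := by ring
    _ = Real.exp x * ∫ θ in Set.Ioc 0 π, Real.exp (-(2 * x / π ^ 2) * θ ^ 2) := by
        rw [intervalIntegral.integral_const_mul, integral_of_le pi_pos.le]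
    _ ≤ Real.exp x * ∫ θ in Set.Ioi 0, Real.exp (-(2 * x / π ^ 2) * θ ^ 2) := by
        gcongr
        · exact ae_of_all _ fun _ => (Real.exp_pos _).le
        · exact hint.integrableOn
        · exact Set.Ioc_subset_Ioi_self
    _ = Real.exp x * (√(π / (2 * x / π ^ 2)) / 2) := by rw [integral_gaussian_Ioi]

theorem sqrt_pi_div_two_sqrt_two_le : √π / (2 * √2) ≤ (√π + 1) / 4 := by
  have hπ : √π < 2 := (Real.sqrt_lt' two_pos).2 (by linarith [pi_lt_four])
  have h2 : √2 < 3 / 2 := (Real.sqrt_lt' (by norm_num)).2 (by norm_num)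
  have h2' : √2 * √2 = 2 := Real.mul_self_sqrt (by norm_num)
  rw [div_le_div_iff₀ (by positivity) (by norm_num)]
  nlinarith [Real.sqrt_nonneg π, Real.sqrt_nonneg 2]

theorem besselI0_le_simple_bound (x : ℝ) (hx : 0 < x) :
    besselI0 x ≤ ((Real.sqrt π + 1) / 4) * Real.exp x / Real.sqrt x := by
  have hsqrt : √(π / (2 * x / π ^ 2)) = π * √π / (√2 * √x) := by
    rw [show π / (2 * x / π ^ 2) = π ^ 2 * π / (2 * x) by field_simp,
      Real.sqrt_div (by positivity), Real.sqrt_mul (by positivity), Real.sqrt_sq pi_pos.le,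
      Real.sqrt_mul zero_le_two]
  calc besselI0 x ≤ (1 / π) * (Real.exp x * (√(π / (2 * x / π ^ 2)) / 2)) := by
        unfold besselI0
        gcongr
        exact integral_exp_mul_cos_le x hx
    _ = √π / (2 * √2) * Real.exp x / √x := by
        rw [hsqrt]
        field_simp
    _ ≤ (√π + 1) / 4 * Real.exp x / √x := by
        gcongr ?_ * _ / _
        exact sqrt_pi_div_two_sqrt_two_le
end

section
/- For every real q with 0 < q < 1, the function κ(j, q) = q^{j(j+1)/2} / (j·(1 − q^j)) is nonincreasing in the integer j ≥ 1; that is, for all integers j ≥ 1, q^{(j+1)(j+2)/2} / ((j+1)·(1 − q^{j+1})) ≤ q^{j(j+1)/2} / (j·(1 − q^j)). -/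
open Real

/-- Monotonicity in `j` of `κ(j,q) = q^{j(j+1)/2}/(j(1−q^j))` for `0 < q < 1`. -/
theorem kappa_antitone (q : ℝ) (hq0 : 0 < q) (hq1 : q < 1) (j : ℕ) (hj : 1 ≤ j) :
    q ^ (((j : ℝ) + 1) * ((j : ℝ) + 2) / 2) / (((j : ℝ) + 1) * (1 - q ^ (j + 1)))
      ≤ q ^ ((j : ℝ) * ((j : ℝ) + 1) / 2) / ((j : ℝ) * (1 - q ^ j)) := by
  have hj0 : (0 : ℝ) < j := by exact_mod_cast hj
  have hpow : q ^ j < 1 := pow_lt_one₀ hq0.le hq1 (by omega)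
  have hsucc : q ^ (j + 1) ≤ q ^ j := pow_le_pow_of_le_one hq0.le hq1.le j.le_succ
  refine div_le_div₀ (rpow_nonneg hq0.le _) ?_ (mul_pos hj0 (sub_pos.2 hpow)) ?_
  · exact rpow_le_rpow_of_exponent_ge hq0 hq1.le (by nlinarith)
  · exact mul_le_mul (by linarith) (by linarith) (by linarith) (by linarith)
end

section
/- For every σ² > 0, the differential entropy (in nats) of the wrapped Gaussian distribution with variance σ² satisfies −∫_{−π}^{π} p_Δ(x) ln p_Δ(x) dx ≥ ln(2π) − 2·e^{−σ²}/(1 − e^{−σ²}). -/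
open Real MeasureTheory intervalIntegral

/-- The density of the wrapped Gaussian distribution with variance `σ²` on `[−π, π)`. -/
noncomputable def wrappedGaussianPdf (σ2 x : ℝ) : ℝ :=
  ∑' k : ℤ, (1 / Real.sqrt (2 * π * σ2)) * Real.exp (-(x - 2 * π * k) ^ 2 / (2 * σ2))

theorem integral_cos_int_mul (k : ℤ) :
    ∫ x in (-π)..π, Real.cos (k * x) = if k = 0 then 2 * π else 0 := by
  split_ifs with h
  · simp [h, two_mul]
  · have hk : (k : ℝ) ≠ 0 := by exact_mod_cast h
    rw [intervalIntegral.integral_comp_mul_left _ hk, integral_cos]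
    simp [Real.sin_int_mul_pi]

theorem integral_cos_int_mul_mul_cos_int_mul (n m : ℤ) :
    ∫ x in (-π)..π, Real.cos (n * x) * Real.cos (m * x) =
      (if n = m then π else 0) + if n = -m then π else 0 := by
  have h (x : ℝ) : Real.cos (n * x) * Real.cos (m * x) =
      1 / 2 * (Real.cos ((n - m : ℤ) * x) + Real.cos ((n + m : ℤ) * x)) := by
    push_cast
    rw [sub_mul, add_mul, Real.cos_sub, Real.cos_add]
    ring
  simp_rw [h]
  rw [intervalIntegral.integral_const_mul, intervalIntegral.integral_add
    (Continuous.intervalIntegrable (by fun_prop) _ _)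
    (Continuous.intervalIntegrable (by fun_prop) _ _),
    integral_cos_int_mul, integral_cos_int_mul]
  simp only [sub_eq_zero, ← eq_neg_iff_add_eq_zero]
  split_ifs <;> ring

theorem continuous_tsum_mul_cos {c : ℤ → ℝ} (hc : Summable fun n => |c n|) :
    Continuous fun x : ℝ => ∑' n : ℤ, c n * Real.cos (n * x) := by
  refine continuous_tsum (fun n => by fun_prop) hc fun n x => ?_
  rw [norm_mul, Real.norm_eq_abs, Real.norm_eq_abs]
  exact mul_le_of_le_one_right (abs_nonneg _) (Real.abs_cos_le_one _)

/-- Termwise integration of an absolutely convergent cosine series against a continuous function. -/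
theorem hasSum_integral_cos_series_mul {c : ℤ → ℝ} (hc : Summable fun n => |c n|)
    {g : ℝ → ℝ} (hg : Continuous g) :
    HasSum (fun n : ℤ => c n * ∫ x in (-π)..π, Real.cos (n * x) * g x)
      (∫ x in (-π)..π, (∑' n : ℤ, c n * Real.cos (n * x)) * g x) := by
  have hle (n : ℤ) (x : ℝ) : ‖c n * Real.cos (n * x)‖ ≤ |c n| := by
    rw [norm_mul, Real.norm_eq_abs, Real.norm_eq_abs]
    exact mul_le_of_le_one_right (abs_nonneg _) (Real.abs_cos_le_one _)
  have key := intervalIntegral.hasSum_integral_of_dominated_convergence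
    (μ := volume) (a := -π) (b := π)
    (F := fun (n : ℤ) (x : ℝ) => c n * Real.cos (n * x) * g x)
    (f := fun x => (∑' n : ℤ, c n * Real.cos (n * x)) * g x)
    (fun n x => |c n| * |g x|)
    (fun n => Continuous.aestronglyMeasurable (by fun_prop))
    (fun n => Filter.Eventually.of_forall fun x _ => by
      rw [norm_mul]
      exact mul_le_mul_of_nonneg_right (hle n x) (norm_nonneg _))
    (Filter.Eventually.of_forall fun x _ => hc.mul_right _)
    (by
      simp_rw [tsum_mul_right]
      exact Continuous.intervalIntegrable (by fun_prop) _ _)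
    (Filter.Eventually.of_forall fun x _ =>
      ((hc.of_norm_bounded fun n => hle n x).hasSum).mul_right _)
  convert! key using 2 with n
  rw [← intervalIntegral.integral_const_mul]
  simp_rw [mul_assoc]

theorem integral_cos_series_mul_cos {c : ℤ → ℝ} (hc : Summable fun n => |c n|)
    (heven : ∀ n, c (-n) = c n) (m : ℤ) :
    ∫ x in (-π)..π, (∑' n : ℤ, c n * Real.cos (n * x)) * Real.cos (m * x) = 2 * π * c m := by
  have h := hasSum_integral_cos_series_mul hc (g := fun x => Real.cos (m * x)) (by fun_prop)
  refine h.unique ?_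
  simp_rw [integral_cos_int_mul_mul_cos_int_mul, mul_add]
  have h1 : HasSum (fun n : ℤ => c n * if n = m then π else 0) (c m * π) := by
    convert! hasSum_ite_eq m (c m * π) using 2 with n
    split_ifs with hn <;> simp [hn]
  have h2 : HasSum (fun n : ℤ => c n * if n = -m then π else 0) (c m * π) := by
    convert! hasSum_ite_eq (-m) (c m * π) using 2 with n
    split_ifs with hn <;> simp [hn, heven]
  convert! h1.add h2 using 1
  ring

/-- Parseval's identity for an absolutely convergent even cosine series indexed by `ℤ`. -/
theorem hasSum_integral_cos_series_sq {c : ℤ → ℝ} (hc : Summable fun n => |c n|)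
    (heven : ∀ n, c (-n) = c n) :
    HasSum (fun n : ℤ => 2 * π * c n ^ 2)
      (∫ x in (-π)..π, (∑' n : ℤ, c n * Real.cos (n * x)) ^ 2) := by
  have h := hasSum_integral_cos_series_mul hc (continuous_tsum_mul_cos hc)
  simp_rw [sq (∑' n : ℤ, _)]
  convert! h using 2 with n
  simp_rw [mul_comm (Real.cos _)]
  rw [integral_cos_series_mul_cos hc heven n]
  ring

theorem hasSum_int_pow_natAbs {q : ℝ} (h0 : 0 ≤ q) (h1 : q < 1) :
    HasSum (fun n : ℤ => q ^ n.natAbs) (1 + 2 * q / (1 - q)) := by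
  have hg := hasSum_geometric_of_lt_one h0 h1
  have h := HasSum.of_nat_of_neg_add_one (f := fun n : ℤ => q ^ n.natAbs)
    (m := (1 - q)⁻¹) (m' := (1 - q)⁻¹ * q) (by simpa using hg)
    (by convert! hg.mul_right q using 2)
  convert! h using 1
  have : 1 - q ≠ 0 := by linarith
  field_simp
  ring

theorem exp_neg_mul_sq_le_pow_natAbs {t : ℝ} (ht : 0 ≤ t) (n : ℤ) :
    Real.exp (-t * n ^ 2) ≤ Real.exp (-t) ^ n.natAbs := by
  rw [← Real.exp_nat_mul, Real.exp_le_exp]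
  have h : (n.natAbs : ℝ) ≤ (n : ℝ) ^ 2 := by
    have : (n.natAbs : ℤ) ≤ n ^ 2 := by
      rw [← Int.natAbs_sq]
      exact Int.le_self_sq _
    rw [← Int.cast_natCast]
    exact_mod_cast this
  nlinarith

theorem summable_exp_neg_mul_int_sq {t : ℝ} (ht : 0 < t) :
    Summable fun n : ℤ => Real.exp (-t * n ^ 2) :=
  (hasSum_int_pow_natAbs (Real.exp_pos (-t)).le (by simpa using ht)).summable.of_nonneg_of_le
    (fun _ => (Real.exp_pos _).le) (exp_neg_mul_sq_le_pow_natAbs ht.le)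

/-- The Fourier expansion of the wrapped Gaussian density. -/
theorem wrappedGaussianPdf_eq_cos_series {σ2 : ℝ} (hσ : 0 < σ2) (x : ℝ) :
    wrappedGaussianPdf σ2 x =
      (2 * π)⁻¹ * ∑' n : ℤ, Real.exp (-(σ2 / 2) * n ^ 2) * Real.cos (n * x) := by
  have hπ := Real.pi_pos
  have hπc : (π : ℂ) ≠ 0 := by exact_mod_cast hπ.ne'
  have hσc : (σ2 : ℂ) ≠ 0 := by exact_mod_cast hσ.ne'
  have ha : 0 < σ2 / (2 * π) := by positivity
  have key := Complex.tsum_exp_neg_quadratic (a := ((σ2 / (2 * π) : ℝ) : ℂ))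
    (by rwa [Complex.ofReal_re]) (Complex.I * x / (2 * π))
  have hR (n : ℤ) : Complex.exp (-π / ((σ2 / (2 * π) : ℝ) : ℂ) *
      (n + Complex.I * (Complex.I * x / (2 * π))) ^ 2) =
      ((Real.exp (-(x - 2 * π * n) ^ 2 / (2 * σ2)) : ℝ) : ℂ) := by
    push_cast
    congr 1
    rw [← mul_div_assoc, ← mul_assoc, Complex.I_mul_I]
    field_simp
    ring
  have hL (n : ℤ) : Complex.exp (-π * ((σ2 / (2 * π) : ℝ) : ℂ) * n ^ 2 +
      2 * π * (Complex.I * x / (2 * π)) * n) =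
      ((Real.exp (-(σ2 / 2) * n ^ 2) : ℝ) : ℂ) * Complex.exp (((n * x : ℝ) : ℂ) * Complex.I) := by
    rw [Complex.ofReal_exp, ← Complex.exp_add]
    congr 1
    push_cast
    field_simp
  simp_rw [hR, hL] at key
  have hpow : ((σ2 / (2 * π) : ℝ) : ℂ) ^ (1 / 2 : ℂ) = ((√(σ2 / (2 * π)) : ℝ) : ℂ) := by
    rw [Real.sqrt_eq_rpow, Complex.ofReal_cpow ha.le]
    norm_num
  rw [hpow] at key
  have hs : Summable fun n : ℤ => ((Real.exp (-(σ2 / 2) * n ^ 2) : ℝ) : ℂ) *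
      Complex.exp (((n * x : ℝ) : ℂ) * Complex.I) := by
    refine (summable_exp_neg_mul_int_sq (half_pos hσ)).of_norm_bounded fun n => ?_
    rw [norm_mul, Complex.norm_exp_ofReal_mul_I, mul_one, Complex.norm_real, Real.norm_eq_abs,
      Real.abs_exp]
  have hre := congrArg Complex.re key
  rw [Complex.re_tsum hs, ← Complex.ofReal_tsum, ← Complex.ofReal_one, ← Complex.ofReal_div,
    ← Complex.ofReal_mul, Complex.ofReal_re] at hre
  simp_rw [Complex.re_ofReal_mul, Complex.exp_ofReal_mul_I_re] at hre
  rw [hre, wrappedGaussianPdf, tsum_mul_left, ← mul_assoc]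
  congr 1
  have h2 : √(2 * π * σ2) = 2 * π * √(σ2 / (2 * π)) := by
    rw [← Real.sqrt_sq (by positivity : 0 ≤ 2 * π), ← Real.sqrt_mul (by positivity),
      Real.sqrt_sq (by positivity)]
    congr 1
    field_simp
  rw [h2]
  field_simp

theorem wrappedGaussianPdf_nonneg (σ2 x : ℝ) : 0 ≤ wrappedGaussianPdf σ2 x :=
  tsum_nonneg fun _ => by positivity

theorem continuous_wrappedGaussianPdf {σ2 : ℝ} (hσ : 0 < σ2) :
    Continuous (wrappedGaussianPdf σ2) := by
  rw [funext (wrappedGaussianPdf_eq_cos_series hσ)]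
  refine continuous_const.mul (continuous_tsum_mul_cos ?_)
  simpa only [Real.abs_exp] using summable_exp_neg_mul_int_sq (half_pos hσ)

theorem integral_wrappedGaussianPdf {σ2 : ℝ} (hσ : 0 < σ2) :
    ∫ x in (-π)..π, wrappedGaussianPdf σ2 x = 1 := by
  have h := integral_cos_series_mul_cos (c := fun n : ℤ => Real.exp (-(σ2 / 2) * n ^ 2))
    (by simpa only [Real.abs_exp] using summable_exp_neg_mul_int_sq (half_pos hσ)) (by simp) 0
  simp only [Int.cast_zero, zero_mul, Real.cos_zero, mul_one] at h
  simp_rw [wrappedGaussianPdf_eq_cos_series hσ]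
  rw [intervalIntegral.integral_const_mul, h]
  have := Real.pi_pos
  simp
  field_simp

theorem integral_wrappedGaussianPdf_sq_le {σ2 : ℝ} (hσ : 0 < σ2) :
    2 * π * ∫ x in (-π)..π, wrappedGaussianPdf σ2 x ^ 2 ≤
      1 + 2 * Real.exp (-σ2) / (1 - Real.exp (-σ2)) := by
  have h := hasSum_integral_cos_series_sq (c := fun n : ℤ => Real.exp (-(σ2 / 2) * n ^ 2))
    (by simpa only [Real.abs_exp] using summable_exp_neg_mul_int_sq (half_pos hσ)) (by simp)
  simp_rw [wrappedGaussianPdf_eq_cos_series hσ, mul_pow]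
  rw [intervalIntegral.integral_const_mul]
  have hπ := Real.pi_pos
  refine hasSum_le (fun n => ?_) ((h.mul_left ((2 * π)⁻¹ ^ 2)).mul_left (2 * π))
    (hasSum_int_pow_natAbs (Real.exp_pos (-σ2)).le (by simpa using hσ))
  refine le_trans (le_of_eq ?_) (exp_neg_mul_sq_le_pow_natAbs hσ.le n)
  rw [← Real.exp_nat_mul]
  field_simp
  congr 1
  push_cast
  ring

theorem mul_log_le_sq_sub {y : ℝ} (hy : 0 ≤ y) {c : ℝ} (hc : 0 < c) :
    y * Real.log y ≤ c * y ^ 2 - (1 + Real.log c) * y := by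
  rcases hy.eq_or_lt with rfl | hy
  · simp
  · have h := Real.log_le_sub_one_of_pos (mul_pos hc hy)
    rw [Real.log_mul hc.ne' hy.ne'] at h
    nlinarith

/-- Lower bound on the differential entropy (in nats) of a wrapped Gaussian:
`h(Δ) ≥ ln(2π) − 2 e^{−σ²}/(1 − e^{−σ²})`. -/
theorem wrappedGaussian_entropy_lower (σ2 : ℝ) (hσ : 0 < σ2) :
    Real.log (2 * π) - 2 * Real.exp (-σ2) / (1 - Real.exp (-σ2)) ≤
      -∫ x in (-π)..π, wrappedGaussianPdf σ2 x * Real.log (wrappedGaussianPdf σ2 x) := by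
  have hcont := continuous_wrappedGaussianPdf hσ
  have hmono : ∫ x in (-π)..π, wrappedGaussianPdf σ2 x * Real.log (wrappedGaussianPdf σ2 x) ≤
      ∫ x in (-π)..π, (2 * π * wrappedGaussianPdf σ2 x ^ 2 -
        (1 + Real.log (2 * π)) * wrappedGaussianPdf σ2 x) :=
    intervalIntegral.integral_mono_on (by linarith [Real.pi_pos])
      ((Real.continuous_mul_log.comp hcont).intervalIntegrable _ _)
      (Continuous.intervalIntegrable (by fun_prop) _ _)
      fun x _ => mul_log_le_sq_sub (wrappedGaussianPdf_nonneg σ2 x) Real.two_pi_pos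
  rw [intervalIntegral.integral_sub (Continuous.intervalIntegrable (by fun_prop) _ _)
    (Continuous.intervalIntegrable (by fun_prop) _ _), intervalIntegral.integral_const_mul,
    intervalIntegral.integral_const_mul, integral_wrappedGaussianPdf hσ] at hmono
  linarith [integral_wrappedGaussianPdf_sq_le hσ]
end

section
/- For every λ > 0, if T has the non-central chi-square density with two degrees of freedom and non-centrality parameter λ, then ∫₀^∞ p_T(t) ln t dt = ln λ + ∫_{λ/2}^∞ (e^{−s}/s) ds. In particular, ∫₀^∞ p_T(t) ln t dt ≥ ln λ. -/
open Real MeasureTheory intervalIntegral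

/-- The density of the non-central chi-square distribution with two degrees of freedom
and non-centrality parameter `λ`. -/
noncomputable def ncChiSqPdf (l t : ℝ) : ℝ :=
  (1 / 2) * Real.exp (-(t + l) / 2) * besselI0 (Real.sqrt (l * t))

theorem Complex.integrable_iff_integrableOn_polarCoord {f : ℂ → ℝ} (hf : Measurable f) :
    Integrable f ↔ IntegrableOn (fun p : ℝ × ℝ ↦ p.1 * f (Complex.polarCoord.symm p))
      (Set.Ioi 0 ×ˢ Set.Ioo (-π) π) := by
  have hm : Measurable fun p : ℝ × ℝ ↦ p.1 * f (Complex.polarCoord.symm p) := by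
    simp only [Complex.polarCoord_symm_apply]
    exact measurable_fst.mul (hf.comp (by fun_prop))
  rw [IntegrableOn, Integrable, Integrable, and_iff_right hf.aestronglyMeasurable,
    and_iff_right hm.aestronglyMeasurable, HasFiniteIntegral, HasFiniteIntegral,
    ← Complex.lintegral_comp_polarCoord_symm]
  rw [polarCoord_target, setLIntegral_congr_fun (measurableSet_Ioi.prod measurableSet_Ioo)]
  rintro p ⟨hp, -⟩
  simp only [smul_eq_mul, enorm_mul, enorm_of_nonneg (le_of_lt hp)]

theorem Complex.integral_eq_integral_polarCoord {f : ℂ → ℝ} (hf : Measurable f)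
    (hfi : Integrable f) :
    ∫ z, f z = ∫ r in Set.Ioi (0 : ℝ), r * ∫ θ in (-π)..π, f (circleMap 0 r θ) := by
  have h := (Complex.integrable_iff_integrableOn_polarCoord hf).1 hfi
  rw [← Complex.integral_comp_polarCoord_symm, polarCoord_target]
  simp only [smul_eq_mul]
  rw [Measure.volume_eq_prod, setIntegral_prod _ h]
  refine setIntegral_congr_fun measurableSet_Ioi fun r _ ↦ ?_
  dsimp only
  rw [integral_of_le (by linarith [pi_pos]), integral_Ioc_eq_integral_Ioo,
    MeasureTheory.integral_const_mul]
  simp [circleMap, Complex.exp_mul_I]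

theorem mul_abs_log_le {r : ℝ} (hr : 0 < r) : r * |log r| ≤ 1 + r ^ 2 := by
  rcases le_total r 1 with h | h
  · have := abs_log_mul_self_lt r hr h
    rw [abs_mul, abs_of_pos hr] at this
    nlinarith [sq_nonneg r]
  · rw [abs_of_nonneg (log_nonneg h)]
    nlinarith [log_le_sub_one_of_pos hr]

theorem integrable_exp_neg_sq_norm_mul_log_norm (c : ℂ) :
    Integrable fun z : ℂ ↦ exp (-‖z - c‖ ^ 2 / 2) * log ‖z‖ := by
  have hm : Measurable fun z : ℂ ↦ exp (-‖z - c‖ ^ 2 / 2) * log ‖z‖ := by fun_prop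
  have hg : Integrable (fun r : ℝ ↦ exp (‖c‖ ^ 2 / 2) * (exp (-(1 / 4) * r ^ 2) +
      r ^ (2 : ℝ) * exp (-(1 / 4) * r ^ 2))) (volume.restrict (Set.Ioi 0)) :=
    (((integrable_exp_neg_mul_sq (by norm_num)).add
      (integrable_rpow_mul_exp_neg_mul_sq (by norm_num) (by norm_num))).const_mul _).restrict
  rw [Complex.integrable_iff_integrableOn_polarCoord hm, IntegrableOn, Measure.volume_eq_prod,
    ← Measure.prod_restrict]
  have hg2 := hg.comp_fst (volume.restrict (Set.Ioo (-π) π))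
  refine hg2.mono' ?_ ?_
  · simp only [Complex.polarCoord_symm_apply]
    exact (measurable_fst.mul (hm.comp (by fun_prop))).aestronglyMeasurable
  · rw [Measure.prod_restrict]
    refine (ae_restrict_iff' (measurableSet_Ioi.prod measurableSet_Ioo)).2 (.of_forall ?_)
    rintro p ⟨hp, -⟩
    have hp : 0 < p.1 := hp
    set z := Complex.polarCoord.symm p
    have hz : ‖z‖ = p.1 := by rw [Complex.norm_polarCoord_symm, abs_of_pos hp]
    have h1 : p.1 ≤ ‖z - c‖ + ‖c‖ := by
      rw [← hz]; simpa using norm_add_le (z - c) c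
    have h2 : exp (-‖z - c‖ ^ 2 / 2) ≤ exp (‖c‖ ^ 2 / 2) * exp (-(1 / 4) * p.1 ^ 2) := by
      rw [← exp_add]
      refine exp_le_exp.2 ?_
      nlinarith [sq_nonneg (‖z - c‖ - ‖c‖), norm_nonneg (z - c), norm_nonneg c]
    rw [hz, norm_mul, norm_mul, norm_of_nonneg hp.le, norm_of_nonneg (exp_pos _).le, rpow_two]
    calc p.1 * (exp (-‖z - c‖ ^ 2 / 2) * ‖log p.1‖)
        = exp (-‖z - c‖ ^ 2 / 2) * (p.1 * |log p.1|) := by rw [norm_eq_abs]; ring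
      _ ≤ (exp (‖c‖ ^ 2 / 2) * exp (-(1 / 4) * p.1 ^ 2)) * (1 + p.1 ^ 2) :=
        mul_le_mul h2 (mul_abs_log_le hp) (by positivity) (by positivity)
      _ = _ := by ring

theorem integral_log_norm_circleMap_add {r c : ℝ} (hr : 0 < r) (hc : 0 < c) :
    ∫ θ in (-π)..π, log ‖circleMap 0 r θ + c‖ = π * log (max (c ^ 2) (r ^ 2)) := by
  have h := circleAverage_log_norm_sub_const_eq_log_radius_add_posLog (c := (0 : ℂ))
    (a := -(c : ℂ)) hr.ne'
  rw [Real.circleAverage_eq_integral_add (-π),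
    integral_comp_add_right (fun θ ↦ log ‖circleMap 0 r θ - -(c : ℂ)‖)] at h
  simp only [sub_neg_eq_add, smul_eq_mul, zero_add, Complex.norm_real, norm_of_nonneg hc.le] at h
  rw [show 2 * π + -π = π by ring, inv_mul_eq_iff_eq_mul₀ (by positivity),
    posLog_eq_log_max_one (by positivity), ← log_mul hr.ne' (by positivity),
    mul_max_of_nonneg _ _ hr.le, mul_one, mul_inv_cancel_left₀ hr.ne'] at h
  have hm : max (c ^ 2) (r ^ 2) = max r c ^ 2 := by
    rcases le_total r c with h | h
    · rw [max_eq_right h, max_eq_left (by gcongr)]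
    · rw [max_eq_left h, max_eq_right (by gcongr)]
  rw [h, hm, log_pow]
  push_cast
  ring

theorem integral_Ioi_two_mul_comp_sq (g : ℝ → ℝ) :
    ∫ r in Set.Ioi (0 : ℝ), 2 * r * g (r ^ 2) = ∫ u in Set.Ioi (0 : ℝ), g u := by
  rw [← integral_comp_rpow_Ioi g (two_ne_zero)]
  refine setIntegral_congr_fun measurableSet_Ioi fun r _ ↦ ?_
  norm_num

theorem integral_ncChiSqPdf_mul_log_eq_integral_complex {l : ℝ} (hl : 0 < l) :
    ∫ t in Set.Ioi (0 : ℝ), ncChiSqPdf l t * log t =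
      (1 / π) * ∫ z : ℂ, exp (-‖z - (√l : ℝ)‖ ^ 2 / 2) * log ‖z‖ := by
  rw [Complex.integral_eq_integral_polarCoord (by fun_prop)
    (integrable_exp_neg_sq_norm_mul_log_norm _), ← integral_Ioi_two_mul_comp_sq,
    ← MeasureTheory.integral_const_mul]
  refine setIntegral_congr_fun measurableSet_Ioi fun r (hr : 0 < r) ↦ ?_
  have hn (θ : ℝ) : ‖circleMap 0 r θ - (√l : ℝ)‖ ^ 2 = r ^ 2 + l - 2 * (√l * r * cos θ) := by
    rw [← Complex.normSq_eq_norm_sq, Complex.normSq_apply]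
    simp [circleMap, Complex.exp_re, Complex.exp_im]
    linear_combination r ^ 2 * sin_sq_add_cos_sq θ + sq_sqrt hl.le
  have he : ∫ θ in (-π)..π, exp (√l * r * cos θ) = 2 * ∫ θ in (0 : ℝ)..π, exp (√l * r * cos θ) := by
    have hi (a b : ℝ) : IntervalIntegrable (fun θ ↦ exp (√l * r * cos θ)) volume a b :=
      Continuous.intervalIntegrable (by fun_prop) _ _
    rw [← integral_add_adjacent_intervals (hi (-π) 0) (hi 0 π), two_mul]
    congr 1
    rw [← neg_zero, ← integral_comp_neg]
    simp
  have hp (θ : ℝ) : exp (-‖circleMap 0 r θ - (√l : ℝ)‖ ^ 2 / 2) * log ‖circleMap 0 r θ‖ =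
      exp (-(r ^ 2 + l) / 2) * log r * exp (√l * r * cos θ) := by
    rw [hn, norm_circleMap_zero, abs_of_pos hr, mul_right_comm _ (log r), ← exp_add]
    congr 2
    ring
  simp only [hp, intervalIntegral.integral_const_mul, he]
  rw [ncChiSqPdf, besselI0, sqrt_mul hl.le, sqrt_sq hr.le, log_pow]
  push_cast
  ring

theorem integral_complex_eq_integral_log_max {l : ℝ} (hl : 0 < l) :
    (1 / π) * ∫ z : ℂ, exp (-‖z - (√l : ℝ)‖ ^ 2 / 2) * log ‖z‖ =
      ∫ u in Set.Ioi (0 : ℝ), (1 / 2) * exp (-u / 2) * log (max l u) := by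
  rw [← integral_add_right_eq_self _ ((√l : ℝ) : ℂ)]
  have hi := (integrable_exp_neg_sq_norm_mul_log_norm (√l : ℝ)).comp_add_right ((√l : ℝ) : ℂ)
  simp only [add_sub_cancel_right] at hi ⊢
  rw [Complex.integral_eq_integral_polarCoord (by fun_prop) hi,
    ← integral_Ioi_two_mul_comp_sq fun u ↦ (1 / 2) * exp (-u / 2) * log (max l u),
    ← MeasureTheory.integral_const_mul]
  refine setIntegral_congr_fun measurableSet_Ioi fun r (hr : 0 < r) ↦ ?_
  simp only [norm_circleMap_zero, sq_abs, intervalIntegral.integral_const_mul]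
  rw [integral_log_norm_circleMap_add hr (sqrt_pos.2 hl), sq_sqrt hl.le]
  field_simp

theorem integrableOn_exp_neg_half_mul_log {l : ℝ} (hl : 0 < l) :
    IntegrableOn (fun u ↦ (1 / 2) * exp (-u / 2) * log u) (Set.Ioi l) := by
  refine integrable_of_isBigO_exp_neg (b := 1 / 4) (by norm_num) ?_ ?_
  · exact ContinuousOn.mul (by fun_prop)
      (continuousOn_log.mono fun u hu ↦ (hl.trans_le hu).ne')
  · have h1 : log =O[Filter.atTop] fun u : ℝ ↦ exp (1 / 4 * u) := by
      have := (isLittleO_pow_exp_pos_mul_atTop 1 (b := 1 / 4) (by norm_num)).isBigO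
      simp only [pow_one] at this
      exact isLittleO_log_id_atTop.isBigO.trans this
    have h2 := ((Asymptotics.isBigO_refl (fun u : ℝ ↦ exp (-u / 2)) Filter.atTop).const_mul_left
      (1 / 2)).mul h1
    refine h2.congr_right fun u ↦ ?_
    rw [← exp_add]
    ring_nf

theorem integrableOn_exp_neg_half {l : ℝ} : IntegrableOn (fun u ↦ exp (-u / 2)) (Set.Ioi l) :=
  (exp_neg_integrableOn_Ioi l (b := 1 / 2) (by norm_num)).congr_fun
    (fun u _ ↦ by ring_nf) measurableSet_Ioi

theorem integrableOn_exp_neg_half_div {l : ℝ} (hl : 0 < l) :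
    IntegrableOn (fun u ↦ exp (-u / 2) / u) (Set.Ioi l) := by
  refine (integrableOn_exp_neg_half.const_mul l⁻¹).mono'
    (Measurable.aestronglyMeasurable (by fun_prop)) ?_
  refine (ae_restrict_iff' measurableSet_Ioi).2 (.of_forall fun u (hu : l < u) ↦ ?_)
  have hu0 := hl.trans hu
  rw [norm_of_nonneg (by positivity), div_eq_inv_mul]
  gcongr

theorem integral_Ioi_exp_neg_half_mul_log {l : ℝ} (hl : 0 < l) :
    ∫ u in Set.Ioi l, (1 / 2) * exp (-u / 2) * log u =
      exp (-l / 2) * log l + ∫ u in Set.Ioi l, exp (-u / 2) / u := by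
  have hd : ∀ u ∈ Set.Ici l, HasDerivAt (fun u ↦ -(exp (-u / 2) * log u))
      ((1 / 2) * exp (-u / 2) * log u - exp (-u / 2) / u) u := fun u hu ↦ by
    have h1 : HasDerivAt (fun u : ℝ ↦ exp (-u / 2)) (exp (-u / 2) * (-1 / 2)) u :=
      ((hasDerivAt_id u).neg.div_const 2).exp
    exact (h1.fun_mul (hasDerivAt_log (hl.trans_le hu).ne')).fun_neg.congr_deriv (by ring)
  have ht : Filter.Tendsto (fun u ↦ -(exp (-u / 2) * log u)) Filter.atTop (nhds 0) := by
    have h : log =o[Filter.atTop] fun u : ℝ ↦ exp (1 / 2 * u) := by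
      have := (isLittleO_pow_exp_pos_mul_atTop 1 (b := 1 / 2) (by norm_num))
      simp only [pow_one] at this
      exact isLittleO_log_id_atTop.trans this
    rw [← neg_zero]
    refine (h.tendsto_div_nhds_zero.congr fun u ↦ ?_).neg
    rw [div_eq_inv_mul, ← exp_neg]
    ring_nf
  have h := integral_Ioi_of_hasDerivAt_of_tendsto' hd
    ((integrableOn_exp_neg_half_mul_log hl).sub (integrableOn_exp_neg_half_div hl)) ht
  rw [integral_sub (integrableOn_exp_neg_half_mul_log hl) (integrableOn_exp_neg_half_div hl)] at h
  linarith

theorem integral_exp_neg_half_mul_log_max {l : ℝ} (hl : 0 < l) :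
    ∫ u in Set.Ioi (0 : ℝ), (1 / 2) * exp (-u / 2) * log (max l u) =
      log l + ∫ s in Set.Ioi (l / 2), exp (-s) / s := by
  have hsub : ∫ s in Set.Ioi (l / 2), exp (-s) / s = ∫ u in Set.Ioi l, exp (-u / 2) / u := by
    have h := integral_comp_mul_left_Ioi (fun s ↦ exp (-s) / s) l (b := 1 / 2) (by norm_num)
    rw [show 1 / 2 * l = l / 2 by ring, smul_eq_mul, ← inv_mul_eq_iff_eq_mul₀ (by norm_num)] at h
    rw [← h, ← MeasureTheory.integral_const_mul]
    refine setIntegral_congr_fun measurableSet_Ioi fun u (hu : l < u) ↦ ?_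
    have hu0 := hl.trans hu
    rw [show -(1 / 2 * u) = -u / 2 by ring]
    field_simp
  have hlow : Set.EqOn (fun u ↦ (1 / 2) * exp (-u / 2) * log (max l u))
      (fun u ↦ (1 / 2) * exp (-u / 2) * log l) (Set.Ioc 0 l) := fun u hu ↦ by
    simp only [max_eq_left hu.2]
  have hhigh : Set.EqOn (fun u ↦ (1 / 2) * exp (-u / 2) * log (max l u))
      (fun u ↦ (1 / 2) * exp (-u / 2) * log u) (Set.Ioi l) := fun u (hu : l < u) ↦ by
    simp only [max_eq_right (le_of_lt hu)]
  have hexp : ∫ u in (0 : ℝ)..l, (1 / 2) * exp (-u / 2) * log l = (1 - exp (-l / 2)) * log l := by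
    rw [integral_eq_sub_of_hasDerivAt (f := fun u ↦ -exp (-u / 2) * log l) fun u _ ↦ ?_]
    · simp
      ring
    · exact Continuous.intervalIntegrable (by fun_prop) _ _
    · have h1 : HasDerivAt (fun u : ℝ ↦ exp (-u / 2)) (exp (-u / 2) * (-1 / 2)) u :=
        ((hasDerivAt_id u).neg.div_const 2).exp
      exact (h1.fun_neg.mul_const (log l)).congr_deriv (by ring)
  rw [← Set.Ioc_union_Ioi_eq_Ioi hl.le, setIntegral_union Set.Ioc_disjoint_Ioi_same
    measurableSet_Ioi, setIntegral_congr_fun measurableSet_Ioc hlow,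
    setIntegral_congr_fun measurableSet_Ioi hhigh, ← integral_of_le hl.le, hexp,
    integral_Ioi_exp_neg_half_mul_log hl, hsub]
  · ring
  · refine IntegrableOn.congr_fun ?_ hlow.symm measurableSet_Ioc
    exact (Continuous.integrableOn_Ioc (by fun_prop))
  · exact (integrableOn_exp_neg_half_mul_log hl).congr_fun hhigh.symm measurableSet_Ioi

/-- `E[ln T] = ln λ − Ei(−λ/2)`, where `−Ei(−λ/2) = ∫_{λ/2}^∞ e^{−s}/s ds ≥ 0`;
in particular `E[ln T] ≥ ln λ`. -/
theorem ncChiSq_log_mean (l : ℝ) (hl : 0 < l) :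
    (∫ t in Set.Ioi (0:ℝ), ncChiSqPdf l t * Real.log t) =
      Real.log l + ∫ s in Set.Ioi (l / 2), Real.exp (-s) / s ∧
    Real.log l ≤ ∫ t in Set.Ioi (0:ℝ), ncChiSqPdf l t * Real.log t := by
  have h : (∫ t in Set.Ioi (0:ℝ), ncChiSqPdf l t * Real.log t) =
      Real.log l + ∫ s in Set.Ioi (l / 2), Real.exp (-s) / s := by
    rw [integral_ncChiSqPdf_mul_log_eq_integral_complex hl, integral_complex_eq_integral_log_max hl,
      integral_exp_neg_half_mul_log_max hl]
  refine ⟨h, h ▸ le_add_of_nonneg_right (setIntegral_nonneg measurableSet_Ioi fun s hs ↦ ?_)⟩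
  exact div_nonneg (exp_pos _).le ((half_pos hl).trans hs).le
end

section
/- For every λ > 0, the differential entropy (in nats) of the non-central chi-square distribution with two degrees of freedom and non-centrality parameter λ satisfies −∫₀^∞ p_T(t) ln p_T(t) dt ≥ (1/2) ln(8π e λ) − ln 3. -/
open Real MeasureTheory intervalIntegral

theorem continuous_besselI0 : Continuous besselI0 := by
  unfold besselI0
  refine continuous_const.mul ?_
  exact continuous_parametric_intervalIntegral_of_continuous'
    (f := fun x θ : ℝ => Real.exp (x * Real.cos θ)) (by fun_prop) 0 π

theorem besselI0_nonneg (x : ℝ) : 0 ≤ besselI0 x := by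
  unfold besselI0
  have := intervalIntegral.integral_nonneg (μ := volume) Real.pi_pos.le
    (fun θ _ => (Real.exp_pos (x * Real.cos θ)).le)
  positivity

/-- The Poisson kernel integral, `∫₀^π dθ / (1 + y (1 - cos θ)) = π / √(1 + 2y)` with
`q = √(1 + 2y)`. -/
theorem integral_inv_one_add_mul_one_sub_cos {q : ℝ} (hq : 1 ≤ q) :
    ∫ θ in (0:ℝ)..π, (1 + (q ^ 2 - 1) / 2 * (1 - Real.cos θ))⁻¹ = π / q := by
  have hden : ∀ θ : ℝ, 0 < (q + 1) - (q - 1) * Real.cos θ := fun θ => by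
    nlinarith [Real.cos_le_one θ]
  have hpos : ∀ θ : ℝ, 0 < 1 + (q ^ 2 - 1) / 2 * (1 - Real.cos θ) := fun θ => by
    nlinarith [mul_nonneg (by nlinarith : (0:ℝ) ≤ (q ^ 2 - 1) / 2)
      (sub_nonneg.2 (Real.cos_le_one θ))]
  have hderiv : ∀ θ : ℝ, HasDerivAt
      (fun θ => θ / q + 2 / q * Real.arctan ((q - 1) * Real.sin θ /
        ((q + 1) - (q - 1) * Real.cos θ)))
      (1 + (q ^ 2 - 1) / 2 * (1 - Real.cos θ))⁻¹ θ := by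
    intro θ
    have h1 := ((Real.hasDerivAt_sin θ).const_mul (q - 1)).div
      (((Real.hasDerivAt_cos θ).const_mul (q - 1)).const_sub (q + 1)) (hden θ).ne'
    have h2 := ((hasDerivAt_id θ).div_const q).add (h1.arctan.const_mul (2 / q))
    refine h2.congr_deriv ?_
    have hd := (hden θ).ne'
    have hp := (hpos θ).ne'
    have hq0 : q ≠ 0 := by positivity
    have hs : Real.sin θ ^ 2 = 1 - Real.cos θ ^ 2 := by
      linarith [Real.sin_sq_add_cos_sq θ]
    have hsum : ((q + 1) - (q - 1) * Real.cos θ) ^ 2 + ((q - 1) * Real.sin θ) ^ 2 =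
        4 * (1 + (q ^ 2 - 1) / 2 * (1 - Real.cos θ)) := by
      linear_combination (q - 1) ^ 2 * hs
    have hinv : 1 / (1 + ((q - 1) * Real.sin θ / ((q + 1) - (q - 1) * Real.cos θ)) ^ 2) =
        ((q + 1) - (q - 1) * Real.cos θ) ^ 2 /
          (4 * (1 + (q ^ 2 - 1) / 2 * (1 - Real.cos θ))) := by
      rw [← hsum, div_pow, one_add_div (pow_ne_zero 2 hd), one_div_div]
    have hnum : (q - 1) * Real.cos θ * ((q + 1) - (q - 1) * Real.cos θ) -
        (q - 1) * Real.sin θ * -((q - 1) * -Real.sin θ) =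
        2 * q - 2 * (1 + (q ^ 2 - 1) / 2 * (1 - Real.cos θ)) := by
      linear_combination (-(q - 1) ^ 2) * hs
    simp only [Pi.div_apply]
    rw [hinv, hnum]
    generalize 1 + (q ^ 2 - 1) / 2 * (1 - Real.cos θ) = P at hp ⊢
    generalize (q + 1) - (q - 1) * Real.cos θ = D at hd ⊢
    field_simp
    ring
  rw [intervalIntegral.integral_eq_sub_of_hasDerivAt (fun θ _ => hderiv θ)]
  · simp
  · exact (Continuous.inv₀ (by fun_prop) fun θ => (hpos θ).ne').intervalIntegrable _ _

theorem besselI0_le {y : ℝ} (hy : 0 ≤ y) :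
    besselI0 y ≤ Real.exp y / √(1 + 2 * y) := by
  have hq : 1 ≤ √(1 + 2 * y) := Real.one_le_sqrt.2 (by linarith)
  have hintegral := integral_inv_one_add_mul_one_sub_cos hq
  rw [Real.sq_sqrt (by linarith), show (1 + 2 * y - 1) / 2 = y by ring] at hintegral
  have hpos : ∀ θ : ℝ, 0 < 1 + y * (1 - Real.cos θ) := fun θ => by
    nlinarith [mul_nonneg hy (sub_nonneg.2 (Real.cos_le_one θ))]
  have hle : ∫ θ in (0:ℝ)..π, Real.exp (y * Real.cos θ) ≤
      ∫ θ in (0:ℝ)..π, Real.exp y * (1 + y * (1 - Real.cos θ))⁻¹ := by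
    refine intervalIntegral.integral_mono_on Real.pi_pos.le
      (Continuous.intervalIntegrable (by fun_prop) _ _)
      ((continuous_const.mul
        (Continuous.inv₀ (by fun_prop) fun θ => (hpos θ).ne')).intervalIntegrable _ _) ?_
    intro θ _
    rw [show y * Real.cos θ = y + -(y * (1 - Real.cos θ)) by ring, Real.exp_add, Real.exp_neg]
    gcongr
    · exact hpos θ
    · linarith [Real.add_one_le_exp (y * (1 - Real.cos θ))]
  rw [intervalIntegral.integral_const_mul, hintegral] at hle
  calc besselI0 y ≤ (1 / π) * (Real.exp y * (π / √(1 + 2 * y))) := by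
        unfold besselI0; gcongr
    _ = _ := by field_simp

theorem two_mul_sq_mul_exp_neg_sq_le {a r : ℝ} (ha : 0 ≤ a) (hr : 0 ≤ r) :
    2 * a ^ 2 * Real.exp (-(a - r) ^ 2) ≤ 1 + 2 * (a * r) := by
  have har := mul_nonneg ha hr
  rw [Real.exp_neg, ← div_eq_mul_inv, div_le_iff₀ (Real.exp_pos _)]
  refine le_trans ?_ (mul_le_mul_of_nonneg_left
    (Real.quadratic_le_exp_of_nonneg (sq_nonneg (a - r))) (by positivity))
  rcases le_total a r with h | h
  · have : a ^ 2 ≤ a * r := by nlinarith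
    have hs : 0 ≤ (a - r) ^ 2 + ((a - r) ^ 2) ^ 2 / 2 := by positivity
    nlinarith [mul_nonneg (by positivity : 0 ≤ 1 + 2 * (a * r)) hs]
  · obtain ⟨d, rfl⟩ := exists_add_of_le h
    have hd : 0 ≤ d := by linarith
    rw [show r + d - r = d by ring]
    have hrest : 0 ≤ r ^ 2 * d ^ 4 + 2 * r * d ^ 3 + r * d ^ 5 := by positivity
    nlinarith [sq_nonneg (r * d - 1 / 2), sq_nonneg (d ^ 2 - 1)]

theorem continuous_ncChiSqPdf (l : ℝ) : Continuous (ncChiSqPdf l) := by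
  have := continuous_besselI0
  unfold ncChiSqPdf
  fun_prop

theorem ncChiSqPdf_nonneg (l t : ℝ) : 0 ≤ ncChiSqPdf l t := by
  have := besselI0_nonneg (√(l * t))
  unfold ncChiSqPdf
  positivity

theorem ncChiSqPdf_le {l t : ℝ} (hl : 0 ≤ l) (ht : 0 ≤ t) :
    ncChiSqPdf l t ≤ (1 / 2) * Real.exp (-(√l - √t) ^ 2 / 2) / √(1 + 2 * (√l * √t)) := by
  have h := besselI0_le (Real.sqrt_nonneg (l * t))
  calc ncChiSqPdf l t
      ≤ (1 / 2) * Real.exp (-(t + l) / 2) * (Real.exp √(l * t) / √(1 + 2 * √(l * t))) := by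
        unfold ncChiSqPdf; gcongr
    _ = _ := by
        rw [Real.sqrt_mul hl, ← mul_div_assoc, mul_assoc, ← Real.exp_add]
        congr 3
        nlinarith [Real.sq_sqrt hl, Real.sq_sqrt ht]

theorem ncChiSqPdf_le_exp {l t : ℝ} (hl : 0 ≤ l) (ht : 0 ≤ t) :
    ncChiSqPdf l t ≤ (1 / 2) * Real.exp (-(√l - √t) ^ 2 / 2) :=
  (ncChiSqPdf_le hl ht).trans <| div_le_self (by positivity) <|
    Real.one_le_sqrt.2 (by have := mul_nonneg (Real.sqrt_nonneg l) (Real.sqrt_nonneg t); linarith)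

theorem ncChiSqPdf_le_one {l t : ℝ} (hl : 0 ≤ l) (ht : 0 ≤ t) : ncChiSqPdf l t ≤ 1 := by
  have h := ncChiSqPdf_le_exp hl ht
  have : Real.exp (-(√l - √t) ^ 2 / 2) ≤ 1 :=
    Real.exp_le_one_iff.2 (by linarith [sq_nonneg (√l - √t)])
  linarith

theorem ncChiSqPdf_le_exp_linear {l t : ℝ} (hl : 0 ≤ l) (ht : 0 ≤ t) :
    ncChiSqPdf l t ≤ Real.exp (l / 2) * Real.exp (-(1 / 4) * t) := by
  refine (ncChiSqPdf_le_exp hl ht).trans ?_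
  rw [← Real.exp_add]
  have : Real.exp (-(√l - √t) ^ 2 / 2) ≤ Real.exp (l / 2 + -(1 / 4) * t) := by
    apply Real.exp_le_exp.2
    nlinarith [Real.sq_sqrt hl, Real.sq_sqrt ht, sq_nonneg (2 * √l - √t)]
  linarith [Real.exp_pos (-(√l - √t) ^ 2 / 2)]

theorem ncChiSqPdf_sq_le {l t : ℝ} (hl : 0 < l) (ht : 0 ≤ t) :
    ncChiSqPdf l t ^ 2 ≤ 1 / (8 * l) := by
  have hy : 0 < 1 + 2 * (√l * √t) := by positivity
  calc ncChiSqPdf l t ^ 2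
      ≤ ((1 / 2) * Real.exp (-(√l - √t) ^ 2 / 2) / √(1 + 2 * (√l * √t))) ^ 2 :=
        pow_le_pow_left₀ (ncChiSqPdf_nonneg l t) (ncChiSqPdf_le hl.le ht) 2
    _ = (1 / 4) * Real.exp (-(√l - √t) ^ 2) / (1 + 2 * (√l * √t)) := by
        rw [div_pow, Real.sq_sqrt hy.le, mul_pow, ← Real.exp_nat_mul]
        norm_num
        ring_nf
    _ ≤ 1 / (8 * l) := by
        rw [div_le_div_iff₀ hy (by positivity)]
        have := two_mul_sq_mul_exp_neg_sq_le (Real.sqrt_nonneg l) (Real.sqrt_nonneg t)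
        rw [Real.sq_sqrt hl.le] at this
        linarith

theorem integrableOn_ncChiSqPdf {l : ℝ} (hl : 0 ≤ l) :
    IntegrableOn (ncChiSqPdf l) (Set.Ioi 0) := by
  refine Integrable.mono' ((integrableOn_exp_mul_Ioi (by norm_num : -(1 / 4 : ℝ) < 0) 0).const_mul
    (Real.exp (l / 2))) (continuous_ncChiSqPdf l).aestronglyMeasurable ?_
  filter_upwards [ae_restrict_mem measurableSet_Ioi] with t ht
  rw [Real.norm_of_nonneg (ncChiSqPdf_nonneg l t)]
  exact ncChiSqPdf_le_exp_linear hl (le_of_lt ht)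

theorem abs_mul_log_le_two_mul_sqrt {x : ℝ} (hx : 0 ≤ x) (hx1 : x ≤ 1) :
    |x * Real.log x| ≤ 2 * √x := by
  rcases hx.eq_or_lt with rfl | hx
  · simp
  have hs := Real.sqrt_pos.2 hx
  have hlog : 1 - (√x)⁻¹ ≤ Real.log x / 2 := by
    rw [← Real.log_sqrt hx.le]
    exact Real.one_sub_inv_le_log_of_pos hs
  have hmul : x * (√x)⁻¹ = √x := by
    rw [← div_eq_mul_inv, Real.div_sqrt]
  rw [abs_of_nonpos (mul_nonpos_of_nonneg_of_nonpos hx.le (Real.log_nonpos hx.le hx1))]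
  nlinarith [mul_le_mul_of_nonneg_left hlog hx.le]

theorem integrableOn_ncChiSqPdf_mul_log {l : ℝ} (hl : 0 ≤ l) :
    IntegrableOn (fun t => ncChiSqPdf l t * Real.log (ncChiSqPdf l t)) (Set.Ioi 0) := by
  refine Integrable.mono' ((integrableOn_exp_mul_Ioi (by norm_num : -(1 / 8 : ℝ) < 0) 0).const_mul
    (2 * Real.exp (l / 4)))
    (Real.continuous_mul_log.comp (continuous_ncChiSqPdf l)).aestronglyMeasurable ?_
  filter_upwards [ae_restrict_mem measurableSet_Ioi] with t ht
  have ht : 0 ≤ t := le_of_lt ht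
  refine (abs_mul_log_le_two_mul_sqrt (ncChiSqPdf_nonneg l t) (ncChiSqPdf_le_one hl ht)).trans ?_
  rw [mul_assoc, ← Real.exp_add]
  gcongr
  apply Real.sqrt_le_iff.2 ⟨(Real.exp_pos _).le, ?_⟩
  refine (ncChiSqPdf_le_exp_linear hl ht).trans_eq ?_
  rw [← Real.exp_add, ← Real.exp_nat_mul]
  congr 1
  push_cast
  ring

theorem integral_exp_neg_sq_add_sq (a : ℝ) :
    ∫ p : ℝ × ℝ, Real.exp (-((p.1 - a) ^ 2 + p.2 ^ 2) / 2) = 2 * π := by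
  have hg : ∫ x : ℝ, Real.exp (-(1 / 2) * x ^ 2) = √(2 * π) := by
    rw [integral_gaussian]; congr 1; ring
  calc ∫ p : ℝ × ℝ, Real.exp (-((p.1 - a) ^ 2 + p.2 ^ 2) / 2)
      = ∫ p : ℝ × ℝ, Real.exp (-(1 / 2) * (p.1 - a) ^ 2) * Real.exp (-(1 / 2) * p.2 ^ 2) := by
        congr 1 with p
        rw [← Real.exp_add]; congr 1; ring
    _ = √(2 * π) * √(2 * π) := by
        rw [Measure.volume_eq_prod, integral_prod_mul
          (fun x : ℝ => Real.exp (-(1 / 2) * (x - a) ^ 2))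
          (fun y : ℝ => Real.exp (-(1 / 2) * y ^ 2)),
          integral_sub_right_eq_self (fun x : ℝ => Real.exp (-(1 / 2) * x ^ 2)), hg]
    _ = 2 * π := Real.mul_self_sqrt (by positivity)

theorem integral_exp_mul_cos_Ioo (y : ℝ) :
    ∫ θ in Set.Ioo (-π) π, Real.exp (y * Real.cos θ) = 2 * π * besselI0 y := by
  have hi : ∀ u v : ℝ, IntervalIntegrable (fun θ => Real.exp (y * Real.cos θ)) volume u v :=
    fun u v => Continuous.intervalIntegrable (by fun_prop) u v
  have hneg : ∫ θ in (-π)..0, Real.exp (y * Real.cos θ) =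
      ∫ θ in (0:ℝ)..π, Real.exp (y * Real.cos θ) := by
    have := intervalIntegral.integral_comp_neg (a := 0) (b := π)
      (fun θ => Real.exp (y * Real.cos θ))
    simpa using this.symm
  rw [← integral_Ioc_eq_integral_Ioo, ← intervalIntegral.integral_of_le (by linarith [Real.pi_pos]),
    ← intervalIntegral.integral_add_adjacent_intervals (hi _ 0) (hi 0 _), hneg, besselI0]
  field_simp
  ring

theorem integral_ncChiSqPdf {l : ℝ} (hl : 0 ≤ l) :
    ∫ t in Set.Ioi (0:ℝ), ncChiSqPdf l t = 1 := by
  have hpolar := (integral_comp_polarCoord_symm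
    (fun p : ℝ × ℝ => Real.exp (-((p.1 - √l) ^ 2 + p.2 ^ 2) / 2))).trans
    (integral_exp_neg_sq_add_sq √l)
  have hintegral : IntegrableOn (fun p : ℝ × ℝ => p.1 •
      (fun p : ℝ × ℝ => Real.exp (-((p.1 - √l) ^ 2 + p.2 ^ 2) / 2)) (polarCoord.symm p))
      polarCoord.target :=
    not_imp_comm.1 integral_undef (hpolar.trans_ne (by positivity))
  rw [polarCoord_target, Measure.volume_eq_prod] at hpolar hintegral
  rw [setIntegral_prod _ hintegral] at hpolar
  rw [← integral_comp_rpow_Ioi_of_pos (g := ncChiSqPdf l) two_pos]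
  have hcongr : ∀ r ∈ Set.Ioi (0:ℝ),
      (∫ θ in Set.Ioo (-π) π, (r, θ).1 •
        (fun p : ℝ × ℝ => Real.exp (-((p.1 - √l) ^ 2 + p.2 ^ 2) / 2)) (polarCoord.symm (r, θ))) =
      2 * π * ((2 * r ^ ((2:ℝ) - 1)) • ncChiSqPdf l (r ^ (2:ℝ))) := by
    intro r hr
    have hr : 0 < r := hr
    have h1 : ∀ θ : ℝ, (r, θ).1 •
        (fun p : ℝ × ℝ => Real.exp (-((p.1 - √l) ^ 2 + p.2 ^ 2) / 2)) (polarCoord.symm (r, θ)) =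
        r * Real.exp (-(r ^ 2 + l) / 2) * Real.exp (√l * r * Real.cos θ) := by
      intro θ
      simp only [polarCoord_symm_apply, smul_eq_mul]
      rw [mul_assoc, ← Real.exp_add]
      congr 2
      linear_combination (-(r ^ 2) / 2) * Real.sin_sq_add_cos_sq θ - Real.sq_sqrt hl / 2
    simp_rw [h1]
    rw [MeasureTheory.integral_const_mul, integral_exp_mul_cos_Ioo, ncChiSqPdf,
      show (2:ℝ) - 1 = 1 by norm_num, Real.rpow_one, Real.rpow_two, Real.sqrt_mul hl,
      Real.sqrt_sq hr.le, smul_eq_mul]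
    ring
  rw [setIntegral_congr_fun measurableSet_Ioi hcongr, MeasureTheory.integral_const_mul] at hpolar
  exact mul_left_cancel₀ (by positivity : 2 * π ≠ 0) (hpolar.trans (mul_one _).symm)

theorem log_ncChiSqPdf_le {l t : ℝ} (hl : 0 < l) (ht : 0 ≤ t) (hp : 0 < ncChiSqPdf l t) :
    Real.log (ncChiSqPdf l t) ≤
      Real.log 3 - (1 / 2) * Real.log (8 * π * Real.exp 1 * l) := by
  have hpe : π * Real.exp 1 ≤ 9 := by
    nlinarith [Real.pi_lt_d2, Real.exp_one_lt_d9, Real.pi_pos, Real.exp_pos 1]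
  have hbound : ncChiSqPdf l t ^ 2 ≤ 3 ^ 2 / (8 * π * Real.exp 1 * l) := by
    refine (ncChiSqPdf_sq_le hl ht).trans ?_
    rw [div_le_div_iff₀ (by positivity) (by positivity)]
    nlinarith
  have h := Real.log_le_log (by positivity) hbound
  rw [Real.log_div (by norm_num) (by positivity), Real.log_pow, Real.log_pow] at h
  push_cast at h
  linarith

/-- Entropy lower bound (in nats) for the non-central chi-square distribution with two
degrees of freedom: `h(T) ≥ (1/2) ln(8πeλ) − ln 3`. -/
theorem ncChiSq_entropy_lower (l : ℝ) (hl : 0 < l) :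
    (1 / 2) * Real.log (8 * π * Real.exp 1 * l) - Real.log 3 ≤
      -∫ t in Set.Ioi (0:ℝ), ncChiSqPdf l t * Real.log (ncChiSqPdf l t) := by
  have hle : ∫ t in Set.Ioi (0:ℝ), ncChiSqPdf l t * Real.log (ncChiSqPdf l t) ≤
      ∫ t in Set.Ioi (0:ℝ), ncChiSqPdf l t *
        (Real.log 3 - (1 / 2) * Real.log (8 * π * Real.exp 1 * l)) := by
    refine setIntegral_mono_on (integrableOn_ncChiSqPdf_mul_log hl.le)
      ((integrableOn_ncChiSqPdf hl.le).mul_const _) measurableSet_Ioi fun t ht => ?_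
    rcases (ncChiSqPdf_nonneg l t).eq_or_lt with h | h
    · simp [← h]
    · exact mul_le_mul_of_nonneg_left (log_ncChiSqPdf_le hl (le_of_lt ht) h) h.le
  rw [MeasureTheory.integral_mul_const, integral_ncChiSqPdf hl.le, one_mul] at hle
  linarith
end
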